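/- arXiv:2405.13074 — 12 statements merged into one kernel-verified Lean document; each statement's English description precedes it below -/
import Mathlib

section
/- For all n ≥ 0, L(n) = (1/ρ)·( r + (Φ₁·ψ₁ⁿ − Φ₂·ψ₂ⁿ)/(ψ₁ − ψ₂) ) (Binet formula for the generalized Leonardo-Alwyn sequence). -/
/-- Constancy of `L (n + 2) - p * L (n + 1) - q * L n` for the Leonardo-Alwyn recurrence. -/
theorem leonardoAlwyn_second_order {R : Type*} [CommRing R] {p q r : R} {L : ℕ → R}
    (hL2 : L 2 = p * L 1 + q * L 0 + r)
    (hLrec : ∀ n : ℕ, L (n + 3) = (1 + p) * L (n + 2) + (q - p) * L (n + 1) - q * L n) (n : ℕ) :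
    L (n + 2) = p * L (n + 1) + q * L n + r := by
  induction n with
  | zero => exact hL2
  | succ n ih => linear_combination hLrec n + ih

/-- A sequence satisfying an affine second-order recurrence agrees, up to scaling and shift, with a
combination of powers of roots of the characteristic polynomial if the first two terms agree. -/
theorem binet_of_second_order {R : Type*} [CommRing R] {p q r x y A B d : R} {L : ℕ → R}
    (hL : ∀ n : ℕ, L (n + 2) = p * L (n + 1) + q * L n + r)
    (hx : x ^ 2 = p * x + q) (hy : y ^ 2 = p * y + q)
    (h0 : d * ((1 - p - q) * L 0 - r) = A - B)
    (h1 : d * ((1 - p - q) * L 1 - r) = A * x - B * y) (n : ℕ) :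
    d * ((1 - p - q) * L n - r) = A * x ^ n - B * y ^ n := by
  induction n using Nat.twoStepInduction with
  | zero => simpa using h0
  | one => simpa using h1
  | more n ih ih' =>
    linear_combination d * (1 - p - q) * hL n + p * ih' + q * ih - A * x ^ n * hx + B * y ^ n * hy

/-- Binet formula for the generalized Leonardo-Alwyn sequence. -/
theorem leonardoAlwyn_binet
    (p q r a b : ℝ) (hpq : p + q ≠ 1) (hdisc : p ^ 2 + 4 * q > 0)
    (L : ℕ → ℝ)
    (hL0 : L 0 = a) (hL1 : L 1 = b) (hL2 : L 2 = p * b + q * a + r)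
    (hLrec : ∀ n : ℕ, L (n + 3) = (1 + p) * L (n + 2) + (q - p) * L (n + 1) - q * L n)
    (ρ ψ₁ ψ₂ Φ₁ Φ₂ : ℝ)
    (hρ : ρ = 1 - p - q)
    (hψ₁ : ψ₁ = (p + Real.sqrt (p ^ 2 + 4 * q)) / 2)
    (hψ₂ : ψ₂ = (p - Real.sqrt (p ^ 2 + 4 * q)) / 2)
    (hΦ₁ : Φ₁ = ((1 - p - q) * a - r) * ψ₁ + (1 - p - q) * b + (p ^ 2 + p * q - p) * a
        + (p - 1) * r)
    (hΦ₂ : Φ₂ = ((1 - p - q) * a - r) * ψ₂ + (1 - p - q) * b + (p ^ 2 + p * q - p) * a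
        + (p - 1) * r) :
    ∀ n : ℕ, L n = (1 / ρ) * (r + (Φ₁ * ψ₁ ^ n - Φ₂ * ψ₂ ^ n) / (ψ₁ - ψ₂)) := by
  have hsq := Real.sq_sqrt hdisc.le
  have hρ0 : ρ ≠ 0 := fun h => hpq (by linarith)
  have hsub : ψ₁ - ψ₂ = √(p ^ 2 + 4 * q) := by rw [hψ₁, hψ₂]; ring
  have hd : ψ₁ - ψ₂ ≠ 0 := hsub ▸ (Real.sqrt_pos.mpr hdisc).ne'
  have hsum : ψ₁ + ψ₂ = p := by rw [hψ₁, hψ₂]; ring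
  have hroot₁ : ψ₁ ^ 2 = p * ψ₁ + q := by rw [hψ₁]; linear_combination hsq / 4
  have hroot₂ : ψ₂ ^ 2 = p * ψ₂ + q := by rw [hψ₂]; linear_combination hsq / 4
  have hL := leonardoAlwyn_second_order (by rw [hL2, hL1, hL0]) hLrec
  intro n
  have key := binet_of_second_order (A := Φ₁) (B := Φ₂) (d := ψ₁ - ψ₂) hL hroot₁ hroot₂
    (by rw [hL0, hΦ₁, hΦ₂]; ring)
    (by
      rw [hL1, hΦ₁, hΦ₂]
      linear_combination -((1 - p - q) * a - r) * (ψ₁ - ψ₂) * hsum) n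
  rw [← hρ] at key
  rw [← key]
  field_simp
  ring
end

section
/- For all m ≥ 0, the generalized Leonardo-Alwyn hybrid numbers satisfy LaH(m+2) = p•LaH(m+1) + q•LaH(m) + r•Ψ. -/
/-- A solution of the third-order Leonardo-Alwyn recurrence with the right initial values satisfies
the inhomogeneous second-order recurrence. -/
theorem leonardoAlwyn_recurrence {R : Type*} [CommRing R] {p q r : R} {L : ℕ → R}
    (h2 : L 2 = p * L 1 + q * L 0 + r)
    (hrec : ∀ n : ℕ, L (n + 3) = (1 + p) * L (n + 2) + (q - p) * L (n + 1) - q * L n) (n : ℕ) :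
    L (n + 2) = p * L (n + 1) + q * L n + r := by
  induction n with
  | zero => exact h2
  | succ n ih => linear_combination hrec n + ih

/-- Second-order recurrence for generalized Leonardo-Alwyn hybrid numbers:
`LaH (m+2) = p • LaH (m+1) + q • LaH m + r • Ψ`. -/
theorem leonardoAlwyn_hybrid_recurrence
    (p q r a b : ℝ) (L : ℕ → ℝ)
    (hL0 : L 0 = a) (hL1 : L 1 = b) (hL2 : L 2 = p * b + q * a + r)
    (hLrec : ∀ n : ℕ, L (n + 3) = (1 + p) * L (n + 2) + (q - p) * L (n + 1) - q * L n)
    (I E H : Matrix (Fin 2) (Fin 2) ℝ)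
    (hI : I = !![0, 1; -1, 0]) (hE : E = !![1, -1; 1, -1]) (hH : H = !![0, 1; 1, 0])
    (LaH : ℕ → Matrix (Fin 2) (Fin 2) ℝ)
    (hLaH : ∀ m : ℕ, LaH m = L m • (1 : Matrix (Fin 2) (Fin 2) ℝ)
        + L (m + 1) • I + L (m + 2) • E + L (m + 3) • H)
    (Ψ : Matrix (Fin 2) (Fin 2) ℝ) (hΨ : Ψ = 1 + I + E + H) :
    ∀ m : ℕ, LaH (m + 2) = p • LaH (m + 1) + q • LaH m + r • Ψ := by
  intro m
  have hL := leonardoAlwyn_recurrence (by rw [hL2, hL1, hL0]) hLrec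
  simp only [hLaH, hΨ, add_assoc, Nat.reduceAdd]
  linear_combination (norm := module) hL m • (1 : Matrix (Fin 2) (Fin 2) ℝ) + hL (m + 1) • I
    + hL (m + 2) • E + hL (m + 3) • H
end

section
/- For all m ≥ 0, the Leonardo hybrid number satisfies HLe(m) = (2/(φ−ψ)) • (φ^{m+1} • Ψ_φ − ψ^{m+1} • Ψ_ψ) − Ψ, where φ = (1+√5)/2 and ψ = (1−√5)/2. -/
/-- Binet formula for the Leonardo sequence, for the two distinct roots of `x ^ 2 = x + 1`. -/
theorem leonardo_binet {Le : ℕ → ℝ} (hLe0 : Le 0 = 1) (hLe1 : Le 1 = 1)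
    (hLerec : ∀ n : ℕ, Le (n + 2) = Le (n + 1) + Le n + 1) {φ ψ : ℝ}
    (hφ : φ ^ 2 = φ + 1) (hψ : ψ ^ 2 = ψ + 1) (hne : φ - ψ ≠ 0) (n : ℕ) :
    Le n = 2 / (φ - ψ) * (φ ^ (n + 1) - ψ ^ (n + 1)) - 1 := by
  have hc : 2 / (φ - ψ) * (φ - ψ) = 2 := div_mul_cancel₀ 2 hne
  induction n using Nat.twoStepInduction with
  | zero => linear_combination hLe0 - hc
  | one => linear_combination hLe1 - hc - 2 / (φ - ψ) * (hφ - hψ)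
  | more n ih₀ ih₁ =>
    linear_combination hLerec n + ih₀ + ih₁
      - 2 / (φ - ψ) * (φ ^ (n + 1) * hφ - ψ ^ (n + 1) * hψ)

/-- Binet formula for Leonardo hybrid numbers. -/
theorem leonardo_hybrid_binet
    (Le : ℕ → ℝ)
    (hLe0 : Le 0 = 1) (hLe1 : Le 1 = 1)
    (hLerec : ∀ n : ℕ, Le (n + 2) = Le (n + 1) + Le n + 1)
    (I E H : Matrix (Fin 2) (Fin 2) ℝ)
    (hI : I = !![0, 1; -1, 0]) (hE : E = !![1, -1; 1, -1]) (hH : H = !![0, 1; 1, 0])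
    (HLe : ℕ → Matrix (Fin 2) (Fin 2) ℝ)
    (hHLe : ∀ m : ℕ, HLe m = Le m • (1 : Matrix (Fin 2) (Fin 2) ℝ)
        + Le (m + 1) • I + Le (m + 2) • E + Le (m + 3) • H)
    (φ ψ : ℝ) (hφ : φ = (1 + Real.sqrt 5) / 2) (hψ : ψ = (1 - Real.sqrt 5) / 2)
    (Ψ Ψφ Ψψ : Matrix (Fin 2) (Fin 2) ℝ)
    (hΨ : Ψ = 1 + I + E + H)
    (hΨφ : Ψφ = 1 + φ • I + φ ^ 2 • E + φ ^ 3 • H)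
    (hΨψ : Ψψ = 1 + ψ • I + ψ ^ 2 • E + ψ ^ 3 • H) :
    ∀ m : ℕ, HLe m = (2 / (φ - ψ)) • (φ ^ (m + 1) • Ψφ - ψ ^ (m + 1) • Ψψ) - Ψ := by
  intro m
  have h5 : Real.sqrt 5 ^ 2 = 5 := Real.sq_sqrt (by norm_num)
  have hφ2 : φ ^ 2 = φ + 1 := by rw [hφ]; linear_combination h5 / 4
  have hψ2 : ψ ^ 2 = ψ + 1 := by rw [hψ]; linear_combination h5 / 4
  have hne : φ - ψ ≠ 0 := by
    have hsub : φ - ψ = Real.sqrt 5 := by rw [hφ, hψ]; ring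
    rw [hsub]
    positivity
  simp only [hHLe, leonardo_binet hLe0 hLe1 hLerec hφ2 hψ2 hne, hΨ, hΨφ, hΨψ]
  module
end

section
/- For all m ≥ 0, the character of LaH(m) satisfies LaH(m) · (L(m)•1 − L(m+1)•I − L(m+2)•E − L(m+3)•H) = (1/ρ²)·( 2r(1−q−pq)·h(m) − 2r(p²+p+q)·h(m+1) + (1−p²q²)·h(m)² + (1−2p−(p²+q)²)·h(m+1)² − 2q(1+pq+p³)·h(m+1)·h(m) − r² ) • 1, where h(m) = (Φ₁·ψ₁ᵐ − Φ₂·ψ₂ᵐ)/(ψ₁ − ψ₂). -/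
/-- The product of a hybrid number with its conjugate in the matrix realization. -/
lemma hybrid_mul_conj (x y z w : ℝ) :
    (x • (1 : Matrix (Fin 2) (Fin 2) ℝ) + y • !![0, 1; -1, 0] + z • !![1, -1; 1, -1]
        + w • !![0, 1; 1, 0])
      * (x • (1 : Matrix (Fin 2) (Fin 2) ℝ) - y • !![0, 1; -1, 0] - z • !![1, -1; 1, -1]
        - w • !![0, 1; 1, 0])
      = (x ^ 2 + y ^ 2 - 2 * (y * z) - w ^ 2) • (1 : Matrix (Fin 2) (Fin 2) ℝ) := by
  ext i j
  fin_cases i <;> fin_cases j <;> simp [Matrix.mul_apply, Fin.sum_univ_two] <;> ring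

/-- The character of a generalized Leonardo-Alwyn hybrid number. -/
theorem leonardoAlwyn_hybrid_character
    (p q r a b : ℝ) (hpq : p + q ≠ 1) (hdisc : p ^ 2 + 4 * q > 0)
    (L : ℕ → ℝ)
    (hL0 : L 0 = a) (hL1 : L 1 = b) (hL2 : L 2 = p * b + q * a + r)
    (hLrec : ∀ n : ℕ, L (n + 3) = (1 + p) * L (n + 2) + (q - p) * L (n + 1) - q * L n)
    (ρ ψ₁ ψ₂ Φ₁ Φ₂ : ℝ)
    (hρ : ρ = 1 - p - q)
    (hψ₁ : ψ₁ = (p + Real.sqrt (p ^ 2 + 4 * q)) / 2)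
    (hψ₂ : ψ₂ = (p - Real.sqrt (p ^ 2 + 4 * q)) / 2)
    (hΦ₁ : Φ₁ = ((1 - p - q) * a - r) * ψ₁ + (1 - p - q) * b + (p ^ 2 + p * q - p) * a
        + (p - 1) * r)
    (hΦ₂ : Φ₂ = ((1 - p - q) * a - r) * ψ₂ + (1 - p - q) * b + (p ^ 2 + p * q - p) * a
        + (p - 1) * r)
    (I E H : Matrix (Fin 2) (Fin 2) ℝ)
    (hI : I = !![0, 1; -1, 0]) (hE : E = !![1, -1; 1, -1]) (hH : H = !![0, 1; 1, 0])
    (LaH : ℕ → Matrix (Fin 2) (Fin 2) ℝ)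
    (hLaH : ∀ m : ℕ, LaH m = L m • (1 : Matrix (Fin 2) (Fin 2) ℝ)
        + L (m + 1) • I + L (m + 2) • E + L (m + 3) • H)
    (h : ℕ → ℝ)
    (hh : ∀ m : ℕ, h m = (Φ₁ * ψ₁ ^ m - Φ₂ * ψ₂ ^ m) / (ψ₁ - ψ₂)) :
    ∀ m : ℕ, LaH m * (L m • (1 : Matrix (Fin 2) (Fin 2) ℝ)
        - L (m + 1) • I - L (m + 2) • E - L (m + 3) • H)
      = ((1 / ρ ^ 2) * (2 * r * (1 - q - p * q) * h m - 2 * r * (p ^ 2 + p + q) * h (m + 1)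
          + (1 - p ^ 2 * q ^ 2) * (h m) ^ 2 + (1 - 2 * p - (p ^ 2 + q) ^ 2) * (h (m + 1)) ^ 2
          - 2 * q * (1 + p * q + p ^ 3) * (h (m + 1) * h m) - r ^ 2))
        • (1 : Matrix (Fin 2) (Fin 2) ℝ) := by
  have hs : Real.sqrt (p ^ 2 + 4 * q) ^ 2 = p ^ 2 + 4 * q := Real.sq_sqrt hdisc.le
  have hspos : 0 < Real.sqrt (p ^ 2 + 4 * q) := Real.sqrt_pos.mpr hdisc
  have hρ0 : ρ ≠ 0 := by
    rw [hρ]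
    intro h0
    exact hpq (by linarith)
  have hd : ψ₁ - ψ₂ ≠ 0 := by
    have : ψ₁ - ψ₂ = Real.sqrt (p ^ 2 + 4 * q) := by rw [hψ₁, hψ₂]; ring
    rw [this]
    exact hspos.ne'
  have hsum : ψ₁ + ψ₂ = p := by rw [hψ₁, hψ₂]; ring
  have h1sq : ψ₁ ^ 2 = p * ψ₁ + q := by rw [hψ₁]; linear_combination hs / 4
  have h2sq : ψ₂ ^ 2 = p * ψ₂ + q := by rw [hψ₂]; linear_combination hs / 4
  have hrec : ∀ n, h (n + 2) = p * h (n + 1) + q * h n := by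
    intro n
    simp only [hh]
    field_simp
    linear_combination Φ₁ * ψ₁ ^ n * h1sq - Φ₂ * ψ₂ ^ n * h2sq
  have h0 : h 0 = ρ * a - r := by
    rw [hh, div_eq_iff hd, hΦ₁, hΦ₂, hρ]
    ring
  have h1 : h 1 = ρ * b - r := by
    rw [hh, div_eq_iff hd, hΦ₁, hΦ₂, hρ]
    linear_combination ((1 - p - q) * a - r) * (ψ₁ - ψ₂) * hsum
  have hLh : ∀ n, ρ * L n = h n + r ∧ ρ * L (n + 1) = h (n + 1) + r
      ∧ ρ * L (n + 2) = h (n + 2) + r := by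
    intro n
    induction n with
    | zero =>
      refine ⟨by rw [hL0, h0]; ring, by rw [hL1, h1]; ring, ?_⟩
      rw [hL2, hrec, h1, h0, hρ]
      ring
    | succ n ih =>
      obtain ⟨ih0, ih1, ih2⟩ := ih
      refine ⟨ih1, ih2, ?_⟩
      rw [hLrec, hrec (n + 1)]
      linear_combination (1 + p) * ih2 + (q - p) * ih1 - q * ih0 + hrec n
  intro m
  have hL : ∀ n, L n = (h n + r) / ρ := fun n => by
    rw [eq_div_iff hρ0, mul_comm]
    exact (hLh n).1
  rw [hLaH, hI, hE, hH, hybrid_mul_conj, hL m, hL (m + 1), hL (m + 2), hL (m + 3),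
    hrec (m + 1), hrec m]
  congr 1
  field_simp
  ring
end

section
/- For all m ≥ 0, Σ_{j=0}^{m} LaH(j) = (1/ρ) • ( (r·m)•Ψ + (1−p)•LaH(0) + LaH(1) − LaH(m+1) − q•LaH(m) ) (summation formula for generalized Leonardo-Alwyn hybrid numbers). -/
/-- A third-order recurrence with characteristic root `1` comes from an inhomogeneous
second-order recurrence with constant forcing term. -/
theorem second_order_of_third_order {R : Type*} [CommRing R] {p q r : R} {L : ℕ → R}
    (h : L 2 = p * L 1 + q * L 0 + r)
    (hrec : ∀ n, L (n + 3) = (1 + p) * L (n + 2) + (q - p) * L (n + 1) - q * L n) (n : ℕ) :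
    L (n + 2) = p * L (n + 1) + q * L n + r := by
  induction n with
  | zero => exact h
  | succ k ih => linear_combination hrec k + ih

/-- Summation formula for an inhomogeneous second-order recurrence in a module. -/
theorem smul_sum_range_of_second_order {R M : Type*} [CommRing R] [AddCommGroup M] [Module R M]
    {p q r : R} {Ψ : M} {X : ℕ → M}
    (h : ∀ n, X (n + 2) = p • X (n + 1) + q • X n + r • Ψ) (m : ℕ) :
    (1 - p - q) • ∑ j ∈ Finset.range (m + 1), X j
      = (r * (m : R)) • Ψ + (1 - p) • X 0 + X 1 - X (m + 1) - q • X m := by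
  induction m with
  | zero =>
    simp only [zero_add, Finset.sum_range_one, Nat.cast_zero]
    module
  | succ k ih =>
    rw [Finset.sum_range_succ, smul_add, ih, h k]
    push_cast
    module

/-- Summation formula for generalized Leonardo-Alwyn hybrid numbers. -/
theorem leonardoAlwyn_hybrid_sum
    (p q r a b : ℝ) (hpq : p + q ≠ 1)
    (ρ : ℝ) (hρ : ρ = 1 - p - q)
    (L : ℕ → ℝ)
    (hL0 : L 0 = a) (hL1 : L 1 = b) (hL2 : L 2 = p * b + q * a + r)
    (hLrec : ∀ n : ℕ, L (n + 3) = (1 + p) * L (n + 2) + (q - p) * L (n + 1) - q * L n)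
    (I E H : Matrix (Fin 2) (Fin 2) ℝ)
    (hI : I = !![0, 1; -1, 0]) (hE : E = !![1, -1; 1, -1]) (hH : H = !![0, 1; 1, 0])
    (LaH : ℕ → Matrix (Fin 2) (Fin 2) ℝ)
    (hLaH : ∀ m : ℕ, LaH m = L m • (1 : Matrix (Fin 2) (Fin 2) ℝ)
        + L (m + 1) • I + L (m + 2) • E + L (m + 3) • H)
    (Ψ : Matrix (Fin 2) (Fin 2) ℝ) (hΨ : Ψ = 1 + I + E + H) :
    ∀ m : ℕ, ∑ j ∈ Finset.range (m + 1), LaH j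
      = (1 / ρ) • ((r * (m : ℝ)) • Ψ + (1 - p) • LaH 0 + LaH 1 - LaH (m + 1) - q • LaH m) := by
  intro m
  have hL := second_order_of_third_order (p := p) (q := q) (r := r)
    (by rw [hL2, hL1, hL0]) hLrec
  have hX (n : ℕ) : LaH (n + 2) = p • LaH (n + 1) + q • LaH n + r • Ψ := by
    rw [hLaH (n + 2), hLaH (n + 1), hLaH n, hΨ, hL (n + 3), hL (n + 2), hL (n + 1), hL n]
    module
  have hρ0 : ρ ≠ 0 := fun h => hpq (by linarith)
  rw [← smul_sum_range_of_second_order hX m, ← hρ, one_div, inv_smul_smul₀ hρ0]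
end

section
/- For all n ≥ 0, Σ_{m=0}^{n} HLe(m) = HLe(n+2) − (n+2)•Ψ − (2•I + 4•E + 8•H) (summation formula for Leonardo hybrid numbers). -/
/-- Summation formula for Leonardo hybrid numbers. -/
theorem leonardo_hybrid_sum
    (Le : ℕ → ℝ)
    (hLe0 : Le 0 = 1) (hLe1 : Le 1 = 1)
    (hLerec : ∀ n : ℕ, Le (n + 2) = Le (n + 1) + Le n + 1)
    (I E H : Matrix (Fin 2) (Fin 2) ℝ)
    (hI : I = !![0, 1; -1, 0]) (hE : E = !![1, -1; 1, -1]) (hH : H = !![0, 1; 1, 0])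
    (HLe : ℕ → Matrix (Fin 2) (Fin 2) ℝ)
    (hHLe : ∀ m : ℕ, HLe m = Le m • (1 : Matrix (Fin 2) (Fin 2) ℝ)
        + Le (m + 1) • I + Le (m + 2) • E + Le (m + 3) • H)
    (Ψ : Matrix (Fin 2) (Fin 2) ℝ) (hΨ : Ψ = 1 + I + E + H) :
    ∀ n : ℕ, ∑ m ∈ Finset.range (n + 1), HLe m
      = HLe (n + 2) - ((n : ℝ) + 2) • Ψ - ((2 : ℝ) • I + (4 : ℝ) • E + (8 : ℝ) • H) := by
  have hrec (n : ℕ) : HLe (n + 2) = HLe (n + 1) + HLe n + Ψ := by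
    have h3 : Le (n + 2 + 1) = Le (n + 1 + 1) + Le (n + 1) + 1 := hLerec (n + 1)
    have h4 : Le (n + 2 + 2) = Le (n + 1 + 2) + Le (n + 2) + 1 := hLerec (n + 2)
    have h5 : Le (n + 2 + 3) = Le (n + 1 + 3) + Le (n + 3) + 1 := hLerec (n + 3)
    rw [hHLe (n + 2), hLerec n, h3, h4, h5, hHLe (n + 1), hHLe n, hΨ]
    module
  intro n
  induction n with
  | zero =>
    have h2 : Le 2 = 3 := by rw [hLerec 0, hLe1, hLe0]; norm_num
    have h3 : Le 3 = 5 := by rw [hLerec 1, h2, hLe1]; norm_num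
    have h4 : Le 4 = 9 := by rw [hLerec 2, h3, h2]; norm_num
    have h5 : Le 5 = 15 := by rw [hLerec 3, h4, h3]; norm_num
    simp only [zero_add, Finset.sum_range_one, hHLe, hΨ, Nat.reduceAdd, hLe0, hLe1, h2, h3, h4,
      h5, Nat.cast_zero]
    module
  | succ k ih =>
    rw [Finset.sum_range_succ, ih, hrec (k + 1), Nat.cast_add_one]
    module
end

section
/- For every real number t, the series Σ_{m≥0} (tᵐ/m!) • LaH(m) converges in K and its sum equals (1/ρ) • ( (r·e^t)•Ψ + (1/(ψ₁−ψ₂)) • ((Φ₁·e^{ψ₁ t})•Ψ₁ − (Φ₂·e^{ψ₂ t})•Ψ₂) ) (exponential generating function of the generalized Leonardo-Alwyn hybrid numbers). -/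
/-- Binet formula for the generalized Leonardo-Alwyn sequence whose characteristic roots are
`1`, `x` and `y`. -/
theorem leonardoAlwyn_binet_s12 (x y r : ℝ) (L : ℕ → ℝ)
    (h2 : L 2 = (x + y) * L 1 - x * y * L 0 + r)
    (hrec : ∀ n : ℕ, L (n + 3) =
      (1 + (x + y)) * L (n + 2) + (-(x * y) - (x + y)) * L (n + 1) + x * y * L n) (n : ℕ) :
    (1 - x) * (1 - y) * (x - y) * L n = r * (x - y)
      + ((1 - x) * (1 - y) * (L 1 - y * L 0) - (1 - y) * r) * x ^ n
      - ((1 - x) * (1 - y) * (L 1 - x * L 0) - (1 - x) * r) * y ^ n := by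
  induction n using Nat.strong_induction_on with
  | _ n ih =>
    match n with
    | 0 => ring
    | 1 => ring
    | 2 => rw [h2]; ring
    | n + 3 =>
      have e0 := ih n (by lia)
      have e1 := ih (n + 1) (by lia)
      have e2 := ih (n + 2) (by lia)
      rw [hrec]
      linear_combination (1 + (x + y)) * e2 + (-(x * y) - (x + y)) * e1 + x * y * e0

/-- The exponential generating function of a geometric sequence. -/
theorem hasSum_pow_div_factorial_mul_pow (x t : ℝ) :
    HasSum (fun m : ℕ => t ^ m / (m.factorial : ℝ) * x ^ m) (Real.exp (x * t)) := by
  rw [Real.exp_eq_exp_ℝ]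
  have h := NormedSpace.expSeries_div_hasSum_exp (x * t)
  simp only [mul_pow, mul_comm (x ^ _), mul_div_right_comm] at h
  exact h

/-- Exponential generating function of the generalized Leonardo-Alwyn hybrid numbers:
for every real `t`, the series `∑ (t^m / m!) • LaH m` converges with the stated sum. -/
theorem leonardoAlwyn_hybrid_exponential_generating_function
    (p q r a b : ℝ) (hpq : p + q ≠ 1) (hdisc : p ^ 2 + 4 * q > 0)
    (L : ℕ → ℝ)
    (hL0 : L 0 = a) (hL1 : L 1 = b) (hL2 : L 2 = p * b + q * a + r)
    (hLrec : ∀ n : ℕ, L (n + 3) = (1 + p) * L (n + 2) + (q - p) * L (n + 1) - q * L n)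
    (ρ ψ₁ ψ₂ Φ₁ Φ₂ : ℝ)
    (hρ : ρ = 1 - p - q)
    (hψ₁ : ψ₁ = (p + Real.sqrt (p ^ 2 + 4 * q)) / 2)
    (hψ₂ : ψ₂ = (p - Real.sqrt (p ^ 2 + 4 * q)) / 2)
    (hΦ₁ : Φ₁ = ((1 - p - q) * a - r) * ψ₁ + (1 - p - q) * b + (p ^ 2 + p * q - p) * a
        + (p - 1) * r)
    (hΦ₂ : Φ₂ = ((1 - p - q) * a - r) * ψ₂ + (1 - p - q) * b + (p ^ 2 + p * q - p) * a
        + (p - 1) * r)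
    (I E H : Matrix (Fin 2) (Fin 2) ℝ)
    (hI : I = !![0, 1; -1, 0]) (hE : E = !![1, -1; 1, -1]) (hH : H = !![0, 1; 1, 0])
    (LaH : ℕ → Matrix (Fin 2) (Fin 2) ℝ)
    (hLaH : ∀ m : ℕ, LaH m = L m • (1 : Matrix (Fin 2) (Fin 2) ℝ)
        + L (m + 1) • I + L (m + 2) • E + L (m + 3) • H)
    (Ψ Ψ₁ Ψ₂ : Matrix (Fin 2) (Fin 2) ℝ)
    (hΨ : Ψ = 1 + I + E + H)
    (hΨ₁ : Ψ₁ = 1 + ψ₁ • I + ψ₁ ^ 2 • E + ψ₁ ^ 3 • H)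
    (hΨ₂ : Ψ₂ = 1 + ψ₂ • I + ψ₂ ^ 2 • E + ψ₂ ^ 3 • H) :
    ∀ t : ℝ, HasSum (fun m : ℕ => (t ^ m / (m.factorial : ℝ)) • LaH m)
      ((1 / ρ) • ((r * Real.exp t) • Ψ
        + (1 / (ψ₁ - ψ₂)) • ((Φ₁ * Real.exp (ψ₁ * t)) • Ψ₁
            - (Φ₂ * Real.exp (ψ₂ * t)) • Ψ₂))) := by
  intro t
  have hsq : Real.sqrt (p ^ 2 + 4 * q) ^ 2 = p ^ 2 + 4 * q := Real.sq_sqrt hdisc.le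
  have hd : ψ₁ - ψ₂ ≠ 0 := by
    have hpos := Real.sqrt_pos.mpr hdisc
    rw [hψ₁, hψ₂]
    linarith
  have hp : p = ψ₁ + ψ₂ := by rw [hψ₁, hψ₂]; ring
  have hq : q = -(ψ₁ * ψ₂) := by rw [hψ₁, hψ₂]; linear_combination hsq / -4
  have hρ0 : ρ ≠ 0 := fun h => hpq (by linarith)
  clear hψ₁ hψ₂ hsq hdisc hpq
  have hL : ∀ n, L n = 1 / ρ * (r + 1 / (ψ₁ - ψ₂) * (Φ₁ * ψ₁ ^ n - Φ₂ * ψ₂ ^ n)) := by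
    intro n
    have h := leonardoAlwyn_binet_s12 ψ₁ ψ₂ r L (by rw [hL2, hL1, hL0, hp, hq]; ring)
      (fun n => by rw [hLrec, hp, hq]; ring) n
    rw [hL0, hL1] at h
    field_simp
    rw [hΦ₁, hΦ₂, hρ, hp, hq]
    linear_combination h
  have hterm : ∀ m, LaH m = (1 / ρ) • (r • Ψ
      + (1 / (ψ₁ - ψ₂)) • ((Φ₁ * ψ₁ ^ m) • Ψ₁ - (Φ₂ * ψ₂ ^ m) • Ψ₂)) := by
    intro m
    rw [hLaH, hL m, hL (m + 1), hL (m + 2), hL (m + 3), hΨ, hΨ₁, hΨ₂]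
    module
  have h₀ := hasSum_pow_div_factorial_mul_pow 1 t
  have h₁ := hasSum_pow_div_factorial_mul_pow ψ₁ t
  have h₂ := hasSum_pow_div_factorial_mul_pow ψ₂ t
  rw [one_mul] at h₀
  convert (((h₀.mul_left r).smul_const Ψ).add
    ((((h₁.mul_left Φ₁).smul_const Ψ₁).sub
      ((h₂.mul_left Φ₂).smul_const Ψ₂)).const_smul (1 / (ψ₁ - ψ₂)))).const_smul (1 / ρ) using 2
    with m
  rw [hterm, one_pow]
  module
end

section
/- For all natural numbers n, u, v, the hybrid-valued sequence ℋ satisfies the Vajda identity ℋ(n+u)·ℋ(n+v) − ℋ(n)·ℋ(n+u+v) = (1/(ψ₁−ψ₂)²) • ( Φ₁·Φ₂·(−q)ⁿ·(ψ₁ᵘ−ψ₂ᵘ) • (ψ₁ᵛ • (Ψ₂·Ψ₁) − ψ₂ᵛ • (Ψ₁·Ψ₂)) ). -/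
/-- Vajda identity for a Binet-type sequence with coefficients in a possibly noncommutative
algebra: the coefficients `A` and `B` need not commute. -/
theorem vajda_of_binet {K : Type*} [Ring K] [Algebra ℝ K] (A B : K) (c x y s t : ℝ) (n u v : ℕ) :
    c • ((s * x ^ (n + u)) • A - (t * y ^ (n + u)) • B)
          * c • ((s * x ^ (n + v)) • A - (t * y ^ (n + v)) • B)
        - c • ((s * x ^ n) • A - (t * y ^ n) • B)
          * c • ((s * x ^ (n + u + v)) • A - (t * y ^ (n + u + v)) • B)
      = c ^ 2 • ((s * t * (x * y) ^ n * (x ^ u - y ^ u))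
          • (x ^ v • (B * A) - y ^ v • (A * B))) := by
  simp only [mul_sub, sub_mul, smul_mul_smul_comm, smul_sub]
  module

/-- Vajda identity for the hybrid-valued sequence ℋ. -/
theorem hybrid_H_vajda
    (p q r a b : ℝ) (hpq : p + q ≠ 1) (hdisc : p ^ 2 + 4 * q > 0)
    (ρ ψ₁ ψ₂ Φ₁ Φ₂ : ℝ)
    (hρ : ρ = 1 - p - q)
    (hψ₁ : ψ₁ = (p + Real.sqrt (p ^ 2 + 4 * q)) / 2)
    (hψ₂ : ψ₂ = (p - Real.sqrt (p ^ 2 + 4 * q)) / 2)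
    (hΦ₁ : Φ₁ = ((1 - p - q) * a - r) * ψ₁ + (1 - p - q) * b + (p ^ 2 + p * q - p) * a
        + (p - 1) * r)
    (hΦ₂ : Φ₂ = ((1 - p - q) * a - r) * ψ₂ + (1 - p - q) * b + (p ^ 2 + p * q - p) * a
        + (p - 1) * r)
    (I E H : Matrix (Fin 2) (Fin 2) ℝ)
    (hI : I = !![0, 1; -1, 0]) (hE : E = !![1, -1; 1, -1]) (hH : H = !![0, 1; 1, 0])
    (Ψ₁ Ψ₂ : Matrix (Fin 2) (Fin 2) ℝ)
    (hΨ₁ : Ψ₁ = 1 + ψ₁ • I + ψ₁ ^ 2 • E + ψ₁ ^ 3 • H)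
    (hΨ₂ : Ψ₂ = 1 + ψ₂ • I + ψ₂ ^ 2 • E + ψ₂ ^ 3 • H)
    (HH : ℕ → Matrix (Fin 2) (Fin 2) ℝ)
    (hHH : ∀ n : ℕ, HH n = (1 / (ψ₁ - ψ₂)) • ((Φ₁ * ψ₁ ^ n) • Ψ₁ - (Φ₂ * ψ₂ ^ n) • Ψ₂)) :
    ∀ n u v : ℕ, HH (n + u) * HH (n + v) - HH n * HH (n + u + v)
      = (1 / (ψ₁ - ψ₂) ^ 2) • ((Φ₁ * Φ₂ * (-q) ^ n * (ψ₁ ^ u - ψ₂ ^ u))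
          • (ψ₁ ^ v • (Ψ₂ * Ψ₁) - ψ₂ ^ v • (Ψ₁ * Ψ₂))) := by
  have h_prod : ψ₁ * ψ₂ = -q := by
    rw [hψ₁, hψ₂]
    linear_combination (-1 / 4 : ℝ) * Real.sq_sqrt hdisc.le
  intro n u v
  simp only [hHH]
  rw [vajda_of_binet, h_prod, one_div_pow]
end

section
/- For all natural numbers n, u, v, the generalized Leonardo-Alwyn hybrid numbers satisfy the Vajda identity LaH(n+u)·LaH(n+v) − LaH(n)·LaH(n+u+v) = (1/ρ²) • ( (1/(ψ₁−ψ₂)²) • (Φ₁·Φ₂·(−q)ⁿ·(ψ₁ᵘ−ψ₂ᵘ)) • (ψ₁ᵛ • (Ψ₂·Ψ₁) − ψ₂ᵛ • (Ψ₁·Ψ₂)) + r • (Ψ·𝒦(n+v,u) − 𝒦(n,u)·Ψ) ), where 𝒦(n,u) = ℋ(n) − ℋ(n+u). -/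
/-- The two-term recurrence behind the homogeneous three-term one. -/
theorem two_term_of_three_term {R : Type*} [CommRing R] {p q r : R} {L : ℕ → R}
    (h2 : L 2 = p * L 1 + q * L 0 + r)
    (hrec : ∀ n, L (n + 3) = (1 + p) * L (n + 2) + (q - p) * L (n + 1) - q * L n) (n : ℕ) :
    L (n + 2) = p * L (n + 1) + q * L n + r := by
  induction n with
  | zero => exact h2
  | succ n ih => linear_combination hrec n + ih

/-- Binet formula for an affine second-order recurrence, cleared of denominators. -/
theorem binet_of_affine_recurrence {R : Type*} [CommRing R] {p q r x y : R} {L : ℕ → R}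
    (hadd : x + y = p) (hmul : x * y = -q)
    (hrec : ∀ n, L (n + 2) = p * L (n + 1) + q * L n + r) (n : ℕ) :
    (x - y) * ((1 - p - q) * L n - r) =
      ((1 - p - q) * L 1 - r - y * ((1 - p - q) * L 0 - r)) * x ^ n
        - ((1 - p - q) * L 1 - r - x * ((1 - p - q) * L 0 - r)) * y ^ n := by
  obtain rfl : q = -(x * y) := by rw [hmul, neg_neg]
  subst hadd
  induction n using Nat.twoStepInduction with
  | zero => ring
  | one => ring
  | more n ih₀ ih₁ =>
    rw [hrec]
    linear_combination (x + y) * ih₁ - x * y * ih₀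

/-- Vajda identity for a difference of two geometric sequences with coefficients `A` and `B` in a
possibly noncommutative algebra. -/
theorem vajda_of_geometric {R K : Type*} [CommRing R] [Ring K] [Algebra R K]
    (x y : R) (A B : K) (n u v : ℕ) :
    (x ^ (n + u) • A - y ^ (n + u) • B) * (x ^ (n + v) • A - y ^ (n + v) • B)
        - (x ^ n • A - y ^ n • B) * (x ^ (n + u + v) • A - y ^ (n + u + v) • B)
      = ((x * y) ^ n * (x ^ u - y ^ u)) • (x ^ v • (B * A) - y ^ v • (A * B)) := by
  simp only [sub_mul, mul_sub, smul_mul_assoc, mul_smul_comm, mul_pow, pow_add]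
  module


/-- Vajda identity for generalized Leonardo-Alwyn hybrid numbers. -/
theorem leonardoAlwyn_hybrid_vajda
    (p q r a b : ℝ) (hpq : p + q ≠ 1) (hdisc : p ^ 2 + 4 * q > 0)
    (L : ℕ → ℝ)
    (hL0 : L 0 = a) (hL1 : L 1 = b) (hL2 : L 2 = p * b + q * a + r)
    (hLrec : ∀ n : ℕ, L (n + 3) = (1 + p) * L (n + 2) + (q - p) * L (n + 1) - q * L n)
    (ρ ψ₁ ψ₂ Φ₁ Φ₂ : ℝ)
    (hρ : ρ = 1 - p - q)
    (hψ₁ : ψ₁ = (p + Real.sqrt (p ^ 2 + 4 * q)) / 2)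
    (hψ₂ : ψ₂ = (p - Real.sqrt (p ^ 2 + 4 * q)) / 2)
    (hΦ₁ : Φ₁ = ((1 - p - q) * a - r) * ψ₁ + (1 - p - q) * b + (p ^ 2 + p * q - p) * a
        + (p - 1) * r)
    (hΦ₂ : Φ₂ = ((1 - p - q) * a - r) * ψ₂ + (1 - p - q) * b + (p ^ 2 + p * q - p) * a
        + (p - 1) * r)
    (I E H : Matrix (Fin 2) (Fin 2) ℝ)
    (hI : I = !![0, 1; -1, 0]) (hE : E = !![1, -1; 1, -1]) (hH : H = !![0, 1; 1, 0])
    (LaH : ℕ → Matrix (Fin 2) (Fin 2) ℝ)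
    (hLaH : ∀ m : ℕ, LaH m = L m • (1 : Matrix (Fin 2) (Fin 2) ℝ)
        + L (m + 1) • I + L (m + 2) • E + L (m + 3) • H)
    (Ψ Ψ₁ Ψ₂ : Matrix (Fin 2) (Fin 2) ℝ)
    (hΨ : Ψ = 1 + I + E + H)
    (hΨ₁ : Ψ₁ = 1 + ψ₁ • I + ψ₁ ^ 2 • E + ψ₁ ^ 3 • H)
    (hΨ₂ : Ψ₂ = 1 + ψ₂ • I + ψ₂ ^ 2 • E + ψ₂ ^ 3 • H)
    (HH : ℕ → Matrix (Fin 2) (Fin 2) ℝ)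
    (hHH : ∀ n : ℕ, HH n = (1 / (ψ₁ - ψ₂)) • ((Φ₁ * ψ₁ ^ n) • Ψ₁ - (Φ₂ * ψ₂ ^ n) • Ψ₂))
    (KK : ℕ → ℕ → Matrix (Fin 2) (Fin 2) ℝ)
    (hKK : ∀ n u : ℕ, KK n u = HH n - HH (n + u)) :
    ∀ n u v : ℕ, LaH (n + u) * LaH (n + v) - LaH n * LaH (n + u + v)
      = (1 / ρ ^ 2) • ((1 / (ψ₁ - ψ₂) ^ 2) • (Φ₁ * Φ₂ * (-q) ^ n * (ψ₁ ^ u - ψ₂ ^ u))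
            • (ψ₁ ^ v • (Ψ₂ * Ψ₁) - ψ₂ ^ v • (Ψ₁ * Ψ₂))
          + r • (Ψ * KK (n + v) u - KK n u * Ψ)) := by
  have hsqrt : Real.sqrt (p ^ 2 + 4 * q) ^ 2 = p ^ 2 + 4 * q := Real.sq_sqrt hdisc.le
  have hadd : ψ₁ + ψ₂ = p := by rw [hψ₁, hψ₂]; ring
  have hmul : ψ₁ * ψ₂ = -q := by rw [hψ₁, hψ₂]; linear_combination -hsqrt / 4
  have hd : ψ₁ - ψ₂ ≠ 0 := by
    have : ψ₁ - ψ₂ = Real.sqrt (p ^ 2 + 4 * q) := by rw [hψ₁, hψ₂]; ring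
    rw [this]
    exact (Real.sqrt_pos.mpr hdisc).ne'
  have hρ0 : ρ ≠ 0 := fun h => hpq (by linear_combination hρ - h)
  have hbinet (m : ℕ) :
      L m = ρ⁻¹ * ((ψ₁ - ψ₂)⁻¹ * (Φ₁ * ψ₁ ^ m - Φ₂ * ψ₂ ^ m) + r) := by
    have h := binet_of_affine_recurrence hadd hmul
      (two_term_of_three_term (by rw [hL0, hL1, hL2]) hLrec) m
    have h₁ : Φ₁ = (1 - p - q) * L 1 - r - ψ₂ * ((1 - p - q) * L 0 - r) := by
      rw [hΦ₁, hL0, hL1]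
      linear_combination ((1 - p - q) * a - r) * hadd
    have h₂ : Φ₂ = (1 - p - q) * L 1 - r - ψ₁ * ((1 - p - q) * L 0 - r) := by
      rw [hΦ₂, hL0, hL1]
      linear_combination ((1 - p - q) * a - r) * hadd
    rw [← h₁, ← h₂, ← hρ] at h
    field_simp
    linear_combination h
  have hLaH_binet (m : ℕ) : LaH m = ρ⁻¹ • (HH m + r • Ψ) := by
    rw [hLaH, hHH, hΨ, hΨ₁, hΨ₂]
    simp only [hbinet, pow_add, one_div]
    module
  have hHH_vajda (n u v : ℕ) : HH (n + u) * HH (n + v) - HH n * HH (n + u + v)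
      = (1 / (ψ₁ - ψ₂) ^ 2) • (Φ₁ * Φ₂ * (-q) ^ n * (ψ₁ ^ u - ψ₂ ^ u))
          • (ψ₁ ^ v • (Ψ₂ * Ψ₁) - ψ₂ ^ v • (Ψ₁ * Ψ₂)) := by
    have hHH' (m : ℕ) :
        HH m = (ψ₁ - ψ₂)⁻¹ • (ψ₁ ^ m • (Φ₁ • Ψ₁) - ψ₂ ^ m • (Φ₂ • Ψ₂)) := by
      rw [hHH, one_div]
      module
    simp only [hHH', smul_mul_smul_comm, ← smul_sub, vajda_of_geometric, hmul]
    simp only [one_div, ← inv_pow]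
    module
  intro n u v
  rw [← hHH_vajda, hKK, hKK, add_right_comm n v u]
  simp only [hLaH_binet, ← smul_sub, add_mul, mul_add, sub_mul, mul_sub,
    smul_mul_assoc, mul_smul_comm, one_div]
  module
end

section
/- (Cassini identity) For every natural number n ≥ 1, LaH(n+1)·LaH(n−1) − (LaH(n))² = (1/ρ²) • ( (1/(ψ₁−ψ₂)²) • (Φ₁·Φ₂·(−q)^{n−1}·(ψ₁−ψ₂)) • (ψ₂ • (Ψ₂·Ψ₁) − ψ₁ • (Ψ₁·Ψ₂)) + r • (Ψ·𝒦(n−1,1) − 𝒦(n,1)·Ψ) ), where 𝒦(n,u) = ℋ(n) − ℋ(n+u). -/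
/-- Binet formula for the generalized Leonardo-Alwyn sequence, cleared of denominators; `x` and `y`
are the roots of `X ^ 2 - p * X - q`. -/
theorem leonardoAlwyn_binet_s16 {p q r a b x y : ℝ} {L : ℕ → ℝ}
    (hL0 : L 0 = a) (hL1 : L 1 = b) (hL2 : L 2 = p * b + q * a + r)
    (hLrec : ∀ n : ℕ, L (n + 3) = (1 + p) * L (n + 2) + (q - p) * L (n + 1) - q * L n)
    (hsum : x + y = p) (hprod : x * y = -q) (n : ℕ) :
    (1 - p - q) * (x - y) * L n
      = (((1 - p - q) * a - r) * x + (1 - p - q) * b + (p ^ 2 + p * q - p) * a + (p - 1) * r) * x ^ n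
        - (((1 - p - q) * a - r) * y + (1 - p - q) * b + (p ^ 2 + p * q - p) * a + (p - 1) * r) * y ^ n
        + r * (x - y) := by
  obtain rfl : q = -(x * y) := by linarith
  subst hsum
  induction n using Nat.strong_induction_on with
  | _ n ih =>
    match n with
    | 0 => rw [hL0]; ring
    | 1 => rw [hL1]; ring
    | 2 => rw [hL2]; ring
    | n + 3 =>
      rw [hLrec]
      linear_combination (1 + (x + y)) * ih (n + 2) (by lia)
        + (-(x * y) - (x + y)) * ih (n + 1) (by lia) + x * y * ih n (by lia)

/-- Cassini identity for the difference of two geometric sequences in a noncommutative algebra. -/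
theorem cassini_geometric_sub {K A : Type*} [CommRing K] [Ring A] [Algebra K A]
    (x y c d : K) (U V : A) (k : ℕ) :
    ((c * x ^ (k + 2)) • U - (d * y ^ (k + 2)) • V) * ((c * x ^ k) • U - (d * y ^ k) • V)
        - ((c * x ^ (k + 1)) • U - (d * y ^ (k + 1)) • V) ^ 2
      = (c * d * (x * y) ^ k * (x - y)) • (y • (V * U) - x • (U * V)) := by
  simp only [sq, sub_mul, mul_sub, smul_mul_assoc, mul_smul_comm]
  module

/-- Cassini identity for generalized Leonardo-Alwyn hybrid numbers. -/
theorem leonardoAlwyn_hybrid_cassini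
    (p q r a b : ℝ) (hpq : p + q ≠ 1) (hdisc : p ^ 2 + 4 * q > 0)
    (L : ℕ → ℝ)
    (hL0 : L 0 = a) (hL1 : L 1 = b) (hL2 : L 2 = p * b + q * a + r)
    (hLrec : ∀ n : ℕ, L (n + 3) = (1 + p) * L (n + 2) + (q - p) * L (n + 1) - q * L n)
    (ρ ψ₁ ψ₂ Φ₁ Φ₂ : ℝ)
    (hρ : ρ = 1 - p - q)
    (hψ₁ : ψ₁ = (p + Real.sqrt (p ^ 2 + 4 * q)) / 2)
    (hψ₂ : ψ₂ = (p - Real.sqrt (p ^ 2 + 4 * q)) / 2)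
    (hΦ₁ : Φ₁ = ((1 - p - q) * a - r) * ψ₁ + (1 - p - q) * b + (p ^ 2 + p * q - p) * a
        + (p - 1) * r)
    (hΦ₂ : Φ₂ = ((1 - p - q) * a - r) * ψ₂ + (1 - p - q) * b + (p ^ 2 + p * q - p) * a
        + (p - 1) * r)
    (I E H : Matrix (Fin 2) (Fin 2) ℝ)
    (hI : I = !![0, 1; -1, 0]) (hE : E = !![1, -1; 1, -1]) (hH : H = !![0, 1; 1, 0])
    (LaH : ℕ → Matrix (Fin 2) (Fin 2) ℝ)
    (hLaH : ∀ m : ℕ, LaH m = L m • (1 : Matrix (Fin 2) (Fin 2) ℝ)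
        + L (m + 1) • I + L (m + 2) • E + L (m + 3) • H)
    (Ψ Ψ₁ Ψ₂ : Matrix (Fin 2) (Fin 2) ℝ)
    (hΨ : Ψ = 1 + I + E + H)
    (hΨ₁ : Ψ₁ = 1 + ψ₁ • I + ψ₁ ^ 2 • E + ψ₁ ^ 3 • H)
    (hΨ₂ : Ψ₂ = 1 + ψ₂ • I + ψ₂ ^ 2 • E + ψ₂ ^ 3 • H)
    (HH : ℕ → Matrix (Fin 2) (Fin 2) ℝ)
    (hHH : ∀ n : ℕ, HH n = (1 / (ψ₁ - ψ₂)) • ((Φ₁ * ψ₁ ^ n) • Ψ₁ - (Φ₂ * ψ₂ ^ n) • Ψ₂))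
    (KK : ℕ → ℕ → Matrix (Fin 2) (Fin 2) ℝ)
    (hKK : ∀ n u : ℕ, KK n u = HH n - HH (n + u)) :
    ∀ n : ℕ, 1 ≤ n → LaH (n + 1) * LaH (n - 1) - (LaH n) ^ 2
      = (1 / ρ ^ 2) • ((1 / (ψ₁ - ψ₂) ^ 2) • (Φ₁ * Φ₂ * (-q) ^ (n - 1) * (ψ₁ - ψ₂))
            • (ψ₂ • (Ψ₂ * Ψ₁) - ψ₁ • (Ψ₁ * Ψ₂))
          + r • (Ψ * KK (n - 1) 1 - KK n 1 * Ψ)) := by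
  intro n hn
  obtain ⟨k, rfl⟩ := Nat.exists_eq_add_of_le' hn
  have hs : 0 < √(p ^ 2 + 4 * q) := Real.sqrt_pos.mpr hdisc
  have hsum : ψ₁ + ψ₂ = p := by rw [hψ₁, hψ₂]; ring
  have hprod : ψ₁ * ψ₂ = -q := by
    rw [hψ₁, hψ₂]
    linear_combination -(1 / 4) * Real.sq_sqrt hdisc.le
  have hd : ψ₁ - ψ₂ ≠ 0 := by
    rw [hψ₁, hψ₂]
    exact ne_of_gt (by linarith)
  have hρ0 : ρ ≠ 0 := fun h => hpq (by linarith)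
  have hL (m : ℕ) :
      L m = (1 / ρ) * ((1 / (ψ₁ - ψ₂)) * (Φ₁ * ψ₁ ^ m - Φ₂ * ψ₂ ^ m) + r) := by
    have h := leonardoAlwyn_binet_s16 hL0 hL1 hL2 hLrec hsum hprod m
    rw [← hΦ₁, ← hΦ₂, ← hρ] at h
    field_simp
    linear_combination h
  have hLaH' (m : ℕ) : LaH m = (1 / ρ) • (HH m + r • Ψ) := by
    rw [hLaH, hHH, hΨ, hΨ₁, hΨ₂, hL m, hL (m + 1), hL (m + 2), hL (m + 3)]
    module
  have hHH' : HH (k + 2) * HH k - HH (k + 1) ^ 2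
      = (1 / (ψ₁ - ψ₂) ^ 2) • (Φ₁ * Φ₂ * (-q) ^ k * (ψ₁ - ψ₂))
          • (ψ₂ • (Ψ₂ * Ψ₁) - ψ₁ • (Ψ₁ * Ψ₂)) := by
    rw [← hprod, ← cassini_geometric_sub, hHH, hHH, hHH, smul_mul_smul_comm, smul_pow, smul_sub,
      ← sq, one_div_pow]
  rw [Nat.add_sub_cancel, ← hHH', hKK, hKK, hLaH', hLaH', hLaH', smul_mul_smul_comm, smul_pow,
    ← sq, one_div_pow, ← smul_sub]
  congr 1
  simp only [sq, add_mul, mul_add, sub_mul, mul_sub, smul_mul_assoc, mul_smul_comm]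
  module
end

section
/- (d'Ocagne identity) For all natural numbers m, n with m ≥ n, LaH(n+1)·LaH(m) − LaH(n)·LaH(m+1) = (1/ρ²) • ( (1/(ψ₁−ψ₂)²) • (Φ₁·Φ₂·(−q)ⁿ·(ψ₁−ψ₂)) • (ψ₁^{m−n} • (Ψ₂·Ψ₁) − ψ₂^{m−n} • (Ψ₁·Ψ₂)) + r • (Ψ·𝒦(m,1) − 𝒦(n,1)·Ψ) ), where 𝒦(n,u) = ℋ(n) − ℋ(n+u). -/
/-- A Binet formula: if `L` satisfies the third-order recurrence whose characteristic roots are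
`1`, `x`, `y`, then it is the sum of a constant and a combination of the powers of `x` and `y`. -/
theorem binet_of_recurrence {p q ρ r x y c d : ℝ} {L : ℕ → ℝ} (hx : x ^ 2 = p * x + q)
    (hy : y ^ 2 = p * y + q)
    (hLrec : ∀ n : ℕ, L (n + 3) = (1 + p) * L (n + 2) + (q - p) * L (n + 1) - q * L n)
    (h0 : ρ * L 0 = c - d + r) (h1 : ρ * L 1 = c * x - d * y + r)
    (h2 : ρ * L 2 = c * x ^ 2 - d * y ^ 2 + r) (n : ℕ) :
    ρ * L n = c * x ^ n - d * y ^ n + r := by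
  induction n using Nat.strong_induction_on with
  | _ n ih =>
    match n with
    | 0 => simpa using h0
    | 1 => simpa using h1
    | 2 => exact h2
    | n + 3 =>
      have e0 := ih n (by lia)
      have e1 := ih (n + 1) (by lia)
      have e2 := ih (n + 2) (by lia)
      rw [hLrec]
      linear_combination (1 + p) * e2 + (q - p) * e1 - q * e0
        - c * x ^ n * (x - 1) * hx + d * y ^ n * (y - 1) * hy

/-- The d'Ocagne expression of a combination `n ↦ (c * x ^ n) • X - (d * y ^ n) • Y` of two
geometric progressions in an algebra. -/
theorem docagne_of_geometric {A : Type*} [Ring A] [Algebra ℝ A] (c d x y : ℝ) (X Y : A)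
    (n k : ℕ) :
    ((c * x ^ (n + 1)) • X - (d * y ^ (n + 1)) • Y)
          * ((c * x ^ (n + k)) • X - (d * y ^ (n + k)) • Y)
        - ((c * x ^ n) • X - (d * y ^ n) • Y)
          * ((c * x ^ (n + k + 1)) • X - (d * y ^ (n + k + 1)) • Y)
      = (c * d * (x * y) ^ n * (x - y)) • (x ^ k • (Y * X) - y ^ k • (X * Y)) := by
  simp only [sub_mul, mul_sub, smul_mul_assoc, mul_smul_comm]
  module

/-- d'Ocagne identity for generalized Leonardo-Alwyn hybrid numbers. -/
theorem leonardoAlwyn_hybrid_docagne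
    (p q r a b : ℝ) (hpq : p + q ≠ 1) (hdisc : p ^ 2 + 4 * q > 0)
    (L : ℕ → ℝ)
    (hL0 : L 0 = a) (hL1 : L 1 = b) (hL2 : L 2 = p * b + q * a + r)
    (hLrec : ∀ n : ℕ, L (n + 3) = (1 + p) * L (n + 2) + (q - p) * L (n + 1) - q * L n)
    (ρ ψ₁ ψ₂ Φ₁ Φ₂ : ℝ)
    (hρ : ρ = 1 - p - q)
    (hψ₁ : ψ₁ = (p + Real.sqrt (p ^ 2 + 4 * q)) / 2)
    (hψ₂ : ψ₂ = (p - Real.sqrt (p ^ 2 + 4 * q)) / 2)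
    (hΦ₁ : Φ₁ = ((1 - p - q) * a - r) * ψ₁ + (1 - p - q) * b + (p ^ 2 + p * q - p) * a
        + (p - 1) * r)
    (hΦ₂ : Φ₂ = ((1 - p - q) * a - r) * ψ₂ + (1 - p - q) * b + (p ^ 2 + p * q - p) * a
        + (p - 1) * r)
    (I E H : Matrix (Fin 2) (Fin 2) ℝ)
    (hI : I = !![0, 1; -1, 0]) (hE : E = !![1, -1; 1, -1]) (hH : H = !![0, 1; 1, 0])
    (LaH : ℕ → Matrix (Fin 2) (Fin 2) ℝ)
    (hLaH : ∀ m : ℕ, LaH m = L m • (1 : Matrix (Fin 2) (Fin 2) ℝ)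
        + L (m + 1) • I + L (m + 2) • E + L (m + 3) • H)
    (Ψ Ψ₁ Ψ₂ : Matrix (Fin 2) (Fin 2) ℝ)
    (hΨ : Ψ = 1 + I + E + H)
    (hΨ₁ : Ψ₁ = 1 + ψ₁ • I + ψ₁ ^ 2 • E + ψ₁ ^ 3 • H)
    (hΨ₂ : Ψ₂ = 1 + ψ₂ • I + ψ₂ ^ 2 • E + ψ₂ ^ 3 • H)
    (HH : ℕ → Matrix (Fin 2) (Fin 2) ℝ)
    (hHH : ∀ n : ℕ, HH n = (1 / (ψ₁ - ψ₂)) • ((Φ₁ * ψ₁ ^ n) • Ψ₁ - (Φ₂ * ψ₂ ^ n) • Ψ₂))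
    (KK : ℕ → ℕ → Matrix (Fin 2) (Fin 2) ℝ)
    (hKK : ∀ n u : ℕ, KK n u = HH n - HH (n + u)) :
    ∀ m n : ℕ, n ≤ m → LaH (n + 1) * LaH m - LaH n * LaH (m + 1)
      = (1 / ρ ^ 2) • ((1 / (ψ₁ - ψ₂) ^ 2) • (Φ₁ * Φ₂ * (-q) ^ n * (ψ₁ - ψ₂))
            • (ψ₁ ^ (m - n) • (Ψ₂ * Ψ₁) - ψ₂ ^ (m - n) • (Ψ₁ * Ψ₂))
          + r • (Ψ * KK m 1 - KK n 1 * Ψ)) := by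
  have hsq : Real.sqrt (p ^ 2 + 4 * q) ^ 2 = p ^ 2 + 4 * q := Real.sq_sqrt hdisc.le
  have hD : ψ₁ - ψ₂ ≠ 0 := by
    have hpos := Real.sqrt_pos.mpr hdisc
    rw [hψ₁, hψ₂]
    ring_nf at hpos ⊢
    exact hpos.ne'
  have hρ0 : ρ ≠ 0 := fun h => hpq (by linarith)
  have hx : ψ₁ ^ 2 = p * ψ₁ + q := by rw [hψ₁]; linear_combination hsq / 4
  have hy : ψ₂ ^ 2 = p * ψ₂ + q := by rw [hψ₂]; linear_combination hsq / 4
  have hsum : ψ₁ + ψ₂ = p := by rw [hψ₁, hψ₂]; ring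
  have hprod : ψ₁ * ψ₂ = -q := by linear_combination ψ₁ * hsum - hx
  have h0 : ρ * L 0 = Φ₁ / (ψ₁ - ψ₂) - Φ₂ / (ψ₁ - ψ₂) + r := by
    rw [hL0]
    field_simp
    rw [hΦ₁, hΦ₂, hρ]
    ring
  have h1 : ρ * L 1 = Φ₁ / (ψ₁ - ψ₂) * ψ₁ - Φ₂ / (ψ₁ - ψ₂) * ψ₂ + r := by
    rw [hL1]
    field_simp
    rw [hΦ₁, hΦ₂, hρ]
    linear_combination (-((1 - p - q) * a - r) * (ψ₁ - ψ₂)) * hsum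
  have h2 : ρ * L 2 = Φ₁ / (ψ₁ - ψ₂) * ψ₁ ^ 2 - Φ₂ / (ψ₁ - ψ₂) * ψ₂ ^ 2 + r := by
    rw [hx, hy]
    linear_combination ρ * hL2 - ρ * p * hL1 - ρ * q * hL0 + p * h1 + q * h0 + r * hρ
  have hbinet := binet_of_recurrence hx hy hLrec h0 h1 h2
  have hLaH' : ∀ n, LaH n = (1 / ρ) • (HH n + r • Ψ) := by
    intro n
    have hL : ∀ k, L k = (1 / ρ) * ((1 / (ψ₁ - ψ₂)) * (Φ₁ * ψ₁ ^ k - Φ₂ * ψ₂ ^ k) + r) := by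
      intro k
      rw [one_div_mul_eq_div, eq_div_iff hρ0]
      linear_combination hbinet k
    rw [hLaH, hHH, hΨ, hΨ₁, hΨ₂, hL n, hL (n + 1), hL (n + 2), hL (n + 3)]
    module
  intro m n hmn
  obtain ⟨k, rfl⟩ := Nat.exists_eq_add_of_le hmn
  have hHHmul : HH (n + 1) * HH (n + k) - HH n * HH (n + k + 1)
      = (1 / (ψ₁ - ψ₂) ^ 2) • (Φ₁ * Φ₂ * (-q) ^ n * (ψ₁ - ψ₂))
          • (ψ₁ ^ k • (Ψ₂ * Ψ₁) - ψ₂ ^ k • (Ψ₁ * Ψ₂)) := by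
    rw [← hprod, ← docagne_of_geometric]
    simp only [hHH, smul_mul_smul_comm, ← smul_sub, ← sq, one_div_pow]
  rw [Nat.add_sub_cancel_left, ← hHHmul, hKK, hKK]
  simp only [hLaH', add_mul, mul_add, sub_mul, mul_sub, smul_mul_assoc, mul_smul_comm]
  module
end

section
/- For all m ≥ 0, the 3×3 matrix over K given by M(m) = !![LaH(m+3), G(m+4), −q•LaH(m+2); LaH(m+2), G(m+3), −q•LaH(m+1); LaH(m+1), G(m+2), −q•LaH(m)] satisfies M(m) = M(0) · Qᵐ, where G(k+1) = LaH(k+1) − (1+p)•LaH(k) and Q is the 3×3 matrix over K with scalar entries (via the algebra map ℝ → K) Q = !![1+p, q−p, −q; 1, 0, 0; 0, 1, 0]. -/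
/-- Matrix power representation of generalized Leonardo-Alwyn hybrid numbers:
`M m = M 0 * Q ^ m`. -/
theorem leonardoAlwyn_hybrid_matrix_power
    (p q r a b : ℝ) (L : ℕ → ℝ)
    (hL0 : L 0 = a) (hL1 : L 1 = b) (hL2 : L 2 = p * b + q * a + r)
    (hLrec : ∀ n : ℕ, L (n + 3) = (1 + p) * L (n + 2) + (q - p) * L (n + 1) - q * L n)
    (I E H : Matrix (Fin 2) (Fin 2) ℝ)
    (hI : I = !![0, 1; -1, 0]) (hE : E = !![1, -1; 1, -1]) (hH : H = !![0, 1; 1, 0])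
    (LaH : ℕ → Matrix (Fin 2) (Fin 2) ℝ)
    (hLaH : ∀ m : ℕ, LaH m = L m • (1 : Matrix (Fin 2) (Fin 2) ℝ)
        + L (m + 1) • I + L (m + 2) • E + L (m + 3) • H)
    (G : ℕ → Matrix (Fin 2) (Fin 2) ℝ)
    (hG : ∀ k : ℕ, G (k + 1) = LaH (k + 1) - (1 + p) • LaH k)
    (Q : Matrix (Fin 3) (Fin 3) (Matrix (Fin 2) (Fin 2) ℝ))
    (hQ : Q = !![algebraMap ℝ (Matrix (Fin 2) (Fin 2) ℝ) (1 + p),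
                 algebraMap ℝ (Matrix (Fin 2) (Fin 2) ℝ) (q - p),
                 algebraMap ℝ (Matrix (Fin 2) (Fin 2) ℝ) (-q);
                 1, 0, 0;
                 0, 1, 0])
    (M : ℕ → Matrix (Fin 3) (Fin 3) (Matrix (Fin 2) (Fin 2) ℝ))
    (hM : ∀ m : ℕ, M m = !![LaH (m + 3), G (m + 4), -(q • LaH (m + 2));
                            LaH (m + 2), G (m + 3), -(q • LaH (m + 1));
                            LaH (m + 1), G (m + 2), -(q • LaH m)]) :
    ∀ m : ℕ, M m = M 0 * Q ^ m := by
  have hrec (k : ℕ) :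
      LaH (k + 3) = (1 + p) • LaH (k + 2) + (q - p) • LaH (k + 1) - q • LaH k := by
    rw [hLaH (k + 3), hLaH (k + 2), hLaH (k + 1), hLaH k, hLrec (k + 3), hLrec (k + 2),
      hLrec (k + 1), hLrec k]
    module
  have hstep (m : ℕ) : M (m + 1) = M m * Q := by
    rw [hM, hM, hQ]
    ext1 i j
    fin_cases i <;> fin_cases j <;>
      simp [Matrix.mul_apply, Fin.sum_univ_three, Algebra.algebraMap_eq_smul_one, hG, add_assoc,
        -smul_add] <;>
      simp only [hrec] <;> module
  intro m
  induction m with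
  | zero => simp
  | succ m ih => rw [hstep, ih, pow_succ, mul_assoc]
end
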